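/- Let X be a regular curve and f : X → X a homeomorphism. Then the collection of all minimal sets of f is a closed subset of the hyperspace of nonempty closed subsets of X endowed with the Hausdorff metric. -/

import Mathlib

open Set Filter Metric Topology

/-- The defining condition of a regular curve: every point has arbitrarily small
open neighborhoods with finite boundary. (Together with the instance assumptions
`Nonempty`, `CompactSpace`, `ConnectedSpace` on a metric space, this says `X` is a
regular curve.) -/
def regularCurveAx (X : Type*) [MetricSpace X] : Prop :=
  ∀ (x : X) (V : Set X), IsOpen V → x ∈ V →
    ∃ U : Set X, IsOpen U ∧ x ∈ U ∧ U ⊆ V ∧ (frontier U).Finite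

/-- The ω-limit set of `x` under `f`: all limits of `f^[n i] x` along a strictly
increasing sequence of integers `n`. -/
def omegaSet {X : Type*} [MetricSpace X] (f : X → X) (x : X) : Set X :=
  {y | ∃ n : ℕ → ℕ, StrictMono n ∧ Tendsto (fun i => f^[n i] x) atTop (𝓝 y)}

/-- `M` is a minimal set of `f`: nonempty, closed, strongly invariant, and without
any proper nonempty closed strongly invariant subset. -/
def IsMinimalSet {X : Type*} [MetricSpace X] (f : X → X) (M : Set X) : Prop :=
  M.Nonempty ∧ IsClosed M ∧ f '' M = M ∧
    ∀ N : Set X, N ⊆ M → N.Nonempty → IsClosed N → f '' N = N → N = M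

theorem IsPreconnected.inter_frontier_nonempty_of_inter_compl {X : Type*} [TopologicalSpace X]
    {C A : Set X} (hC : IsPreconnected C) (h₁ : (C ∩ A).Nonempty) (h₂ : (C ∩ Aᶜ).Nonempty) :
    (C ∩ frontier A).Nonempty := by
  by_contra h
  have hsub : C ⊆ interior A ∪ interior Aᶜ := by
    rw [← compl_frontier_eq_union_interior]
    exact fun x hx hx' => h ⟨x, hx, hx'⟩
  obtain ⟨x, hx, hxA⟩ := h₁
  obtain ⟨y, hy, hyA⟩ := h₂
  obtain ⟨z, -, hz₁, hz₂⟩ := hC _ _ isOpen_interior isOpen_interior hsub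
    ⟨x, hx, (hsub hx).resolve_right fun h => interior_subset h hxA⟩
    ⟨y, hy, (hsub hy).resolve_left fun h => hyA (interior_subset h)⟩
  exact interior_subset hz₂ (interior_subset hz₁)

section RegularCurve

variable {X : Type*} [MetricSpace X]

/-- Boundary bumping: in a compact connected space, every point of the closure of an open
set with nonempty boundary can be connected inside that closure to the boundary. -/
theorem exists_mem_frontier_mem_connectedComponent [CompactSpace X] [ConnectedSpace X]
    {U : Set X} (hU : IsOpen U) (hfr : (frontier U).Nonempty) (z : closure U) :
    ∃ p : closure U, (p : X) ∈ frontier U ∧ p ∈ connectedComponent z := by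
  by_contra! hcon
  have : CompactSpace (closure U) := isCompact_iff_compactSpace.1 isClosed_closure.isCompact
  have hP : IsClosed (Subtype.val ⁻¹' frontier U : Set (closure U)) :=
    isClosed_frontier.preimage continuous_subtype_val
  have key : ∃ E : {s : Set (closure U) // IsClopen s ∧ z ∈ s},
      E.1 ⊆ (Subtype.val ⁻¹' frontier U)ᶜ := by
    have hd : Directed (· ⊇ ·) fun E : {s : Set (closure U) // IsClopen s ∧ z ∈ s} => E.1 :=
      fun A B => ⟨⟨A.1 ∩ B.1, A.2.1.inter B.2.1, A.2.2, B.2.2⟩, inter_subset_left,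
        inter_subset_right⟩
    have : Nonempty {s : Set (closure U) // IsClopen s ∧ z ∈ s} :=
      ⟨⟨univ, isClopen_univ, mem_univ _⟩⟩
    refine exists_subset_nhds_of_isCompact hd (fun E => E.2.1.isClosed.isCompact) fun x hx => ?_
    rw [← connectedComponent_eq_iInter_isClopen] at hx
    exact hP.isOpen_compl.mem_nhds fun h => hcon x h hx
  obtain ⟨⟨E, hE, hzE⟩, hEP⟩ := key
  have hEU : Subtype.val '' E ⊆ U := by
    rintro _ ⟨x, hx, rfl⟩
    by_contra hxU
    exact hEP hx (by rw [mem_preimage, hU.frontier_eq]; exact ⟨x.2, hxU⟩)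
  have hcl : IsClosed (Subtype.val '' E : Set X) :=
    isClosed_closure.isClosedMap_subtype_val _ hE.isClosed
  have hop : IsOpen (Subtype.val '' E : Set X) := by
    obtain ⟨O, hO, rfl⟩ := isOpen_induced_iff.1 hE.isOpen
    have : (Subtype.val '' (Subtype.val ⁻¹' O : Set (closure U)) : Set X) = O ∩ U := by
      ext x
      constructor
      · intro hx
        refine ⟨?_, hEU hx⟩
        obtain ⟨y, hy, rfl⟩ := hx
        exact hy
      · rintro ⟨hx, hxU⟩
        exact ⟨⟨x, subset_closure hxU⟩, hx, rfl⟩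
    rw [this]
    exact hO.inter hU
  have huniv := IsClopen.eq_univ ⟨hcl, hop⟩ ⟨z, z, hzE, rfl⟩
  obtain ⟨p, hp⟩ := hfr
  have hpU : p ∈ U := hEU (huniv ▸ mem_univ p)
  rw [hU.frontier_eq] at hp
  exact hp.2 hpU

theorem regularCurveAx.locallyConnectedSpace [CompactSpace X] [ConnectedSpace X]
    (hreg : regularCurveAx X) : LocallyConnectedSpace X := by
  rw [locallyConnectedSpace_iff_connected_subsets]
  intro x V hV
  obtain ⟨V', ⟨hV', hV'c⟩, hV'V⟩ := (closed_nhds_basis x).mem_iff.1 hV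
  obtain ⟨U, hU, hxU, hUV, hfin⟩ := hreg x (interior V') isOpen_interior
    (mem_interior_iff_mem_nhds.2 hV')
  have hclV : closure U ⊆ V :=
    (closure_minimal (hUV.trans interior_subset) hV'c).trans hV'V
  rcases (frontier U).eq_empty_or_nonempty with he | hne
  · rcases frontier_eq_empty_iff.1 he with rfl | rfl
    · exact absurd hxU (notMem_empty x)
    · exact ⟨univ, univ_mem, isPreconnected_univ, subset_closure.trans hclV⟩
  · let z : closure U := ⟨x, subset_closure hxU⟩
    refine ⟨Subtype.val '' connectedComponent z, ?_,
      isPreconnected_connectedComponent.image _ continuous_subtype_val.continuousOn, ?_⟩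
    · let T : Set (Set X) := (fun p : closure U => Subtype.val '' connectedComponent p) ''
        {p | (p : X) ∈ frontier U ∧ p ∉ connectedComponent z}
      have hT : T.Finite := by
        refine Set.Finite.image _ ((hfin.preimage Subtype.val_injective.injOn).subset ?_)
        exact fun p hp => hp.1
      have hTc : IsClosed (⋃₀ T) := by
        rw [sUnion_eq_biUnion]
        refine hT.isClosed_biUnion ?_
        rintro _ ⟨p, -, rfl⟩
        exact isClosed_closure.isClosedMap_subtype_val _ isClosed_connectedComponent
      have hxT : x ∉ ⋃₀ T := by
        rintro ⟨_, ⟨p, hp, rfl⟩, ⟨q, hq, hqx⟩⟩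
        have : q = z := Subtype.ext hqx
        subst this
        exact hp.2 (connectedComponent_eq hq ▸ mem_connectedComponent)
      filter_upwards [hU.mem_nhds hxU, hTc.isOpen_compl.mem_nhds hxT] with y hyU hyT
      let y' : closure U := ⟨y, subset_closure hyU⟩
      obtain ⟨p, hp, hpy⟩ := exists_mem_frontier_mem_connectedComponent hU hne y'
      have hpz : p ∈ connectedComponent z := by
        by_contra hpz
        refine hyT ⟨_, ⟨p, ⟨hp, hpz⟩, rfl⟩, y', ?_, rfl⟩
        rw [← connectedComponent_eq hpy]
        exact mem_connectedComponent
      refine ⟨y', ?_, rfl⟩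
      rw [connectedComponent_eq hpz, ← connectedComponent_eq hpy]
      exact mem_connectedComponent
    · rintro _ ⟨p, -, rfl⟩
      exact hclV p.2

theorem regularCurveAx.exists_isClosed_finite_frontier [CompactSpace X]
    (hreg : regularCurveAx X) {N N' : Set X} (hN : IsClosed N) (hN' : IsClosed N')
    (hd : Disjoint N N') :
    ∃ A, IsClosed A ∧ N ⊆ interior A ∧ Disjoint A N' ∧ (frontier A).Finite := by
  have hloc : ∀ x ∈ N, ∃ U : Set X, IsOpen U ∧ x ∈ U ∧ Disjoint (closure U) N' ∧
      (frontier U).Finite := by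
    intro x hx
    obtain ⟨V, ⟨hV, hVc⟩, hVN⟩ := (closed_nhds_basis x).mem_iff.1
      (hN'.isOpen_compl.mem_nhds (hd.notMem_of_mem_left hx))
    obtain ⟨U, hU, hxU, hUV, hfin⟩ := hreg x (interior V) isOpen_interior
      (mem_interior_iff_mem_nhds.2 hV)
    refine ⟨U, hU, hxU, ?_, hfin⟩
    exact (subset_compl_iff_disjoint_right.1 hVN).mono_left
      (closure_minimal (hUV.trans interior_subset) hVc)
  refine hN.isCompact.induction_on
    (p := fun s => ∃ A, IsClosed A ∧ s ⊆ interior A ∧ Disjoint A N' ∧ (frontier A).Finite)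
    ⟨∅, isClosed_empty, empty_subset _, disjoint_bot_left, by simp⟩ ?_ ?_ ?_
  · rintro s t hst ⟨A, hA, hs, h⟩
    exact ⟨A, hA, hst.trans hs, h⟩
  · rintro s t ⟨A, hA, hs, hAd, hAf⟩ ⟨B, hB, ht, hBd, hBf⟩
    refine ⟨A ∪ B, hA.union hB, union_subset (hs.trans (interior_mono subset_union_left))
      (ht.trans (interior_mono subset_union_right)), hAd.union_left hBd, ?_⟩
    refine (hAf.union hBf).subset ((frontier_union_subset A B).trans ?_)
    exact union_subset_union inter_subset_left inter_subset_right
  · intro x hx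
    obtain ⟨U, hU, hxU, hUd, hUf⟩ := hloc x hx
    refine ⟨U, mem_nhdsWithin_of_mem_nhds (hU.mem_nhds hxU), closure U, isClosed_closure,
      hU.subset_interior_iff.2 subset_closure, hUd, hUf.subset frontier_closure_subset⟩

theorem regularCurveAx.exists_finite_forall_dist_lt [CompactSpace X]
    (hreg : regularCurveAx X) {ε : ℝ} (hε : 0 < ε) :
    ∃ F : Set X, F.Finite ∧ ∀ C : Set X, IsPreconnected C → Disjoint C F →
      ∀ x ∈ C, ∀ y ∈ C, dist x y < ε := by
  choose U hU hxU hUb hUf using fun x => hreg x (ball x (ε / 2)) isOpen_ball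
    (mem_ball_self (half_pos hε))
  obtain ⟨t, ht⟩ := isCompact_univ.elim_finite_subcover U hU
    fun x _ => mem_iUnion.2 ⟨x, hxU x⟩
  refine ⟨⋃ i ∈ t, frontier (U i), t.finite_toSet.biUnion fun i _ => hUf i, ?_⟩
  intro C hC hd x hx y hy
  obtain ⟨i, hi, hxi⟩ := mem_iUnion₂.1 (ht (mem_univ x))
  have hyi : y ∈ U i := by
    by_contra hyi
    obtain ⟨z, hzC, hz⟩ := hC.inter_frontier_nonempty_of_inter_compl ⟨x, hx, hxi⟩ ⟨y, hy, hyi⟩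
    exact hd.notMem_of_mem_left hzC (mem_iUnion₂.2 ⟨i, hi, hz⟩)
  have h₁ : dist x i < ε / 2 := hUb i hxi
  have h₂ : dist y i < ε / 2 := hUb i hyi
  linarith [dist_triangle_right x y i]

theorem ncard_frontier_inter_add_ncard_frontier_union_le {A B : Set X}
    (hA : (frontier A).Finite) (hB : (frontier B).Finite) :
    (frontier (A ∩ B)).ncard + (frontier (A ∪ B)).ncard ≤
      (frontier A).ncard + (frontier B).ncard := by
  have h₁ : frontier (A ∩ B) ∪ frontier (A ∪ B) ⊆ frontier A ∪ frontier B := by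
    refine union_subset ((frontier_inter_subset A B).trans ?_)
      ((frontier_union_subset A B).trans ?_)
    · exact union_subset_union inter_subset_left inter_subset_right
    · exact union_subset_union inter_subset_left inter_subset_right
  have h₂ : frontier (A ∩ B) ∩ frontier (A ∪ B) ⊆ frontier A ∩ frontier B := by
    rintro x ⟨⟨hx₁, -⟩, -, hx₂⟩
    have hcl := closure_inter_subset_inter_closure A B hx₁
    exact ⟨⟨hcl.1, fun h => hx₂ (interior_mono subset_union_left h)⟩,
      hcl.2, fun h => hx₂ (interior_mono subset_union_right h)⟩
  have hf : (frontier (A ∩ B)).Finite := (hA.union hB).subset (subset_union_left.trans h₁)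
  have hf' : (frontier (A ∪ B)).Finite := (hA.union hB).subset (subset_union_right.trans h₁)
  rw [← ncard_union_add_ncard_inter _ _ hf hf', ← ncard_union_add_ncard_inter _ _ hA hB]
  exact add_le_add (ncard_le_ncard h₁ (hA.union hB))
    (ncard_le_ncard h₂ (hA.subset inter_subset_left))

theorem finite_frontier_iInter [LocallyConnectedSpace X] {A : ℕ → Set X} (hA : Antitone A)
    (hAc : ∀ r, IsClosed (A r)) (hfin : ∀ r, (frontier (A r)).Finite) {m : ℕ}
    (hm : ∀ r, (frontier (A r)).ncard ≤ m) : (frontier (⋂ r, A r)).Finite := by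
  by_contra hinf
  obtain ⟨t, htK, htc⟩ := Set.Infinite.exists_subset_card_eq hinf (m + 1)
  obtain ⟨O, hO, hOd⟩ := t.finite_toSet.t2_separation
  have hK : IsClosed (⋂ r, A r) := isClosed_iInter hAc
  have hr : ∀ p ∈ t, ∀ᶠ r in atTop, (O p ∩ frontier (A r)).Nonempty := by
    intro p hp
    obtain ⟨W, hW, hWc, hWO⟩ := locallyConnectedSpace_iff_connected_subsets.1 ‹_› p (O p)
      ((hO p).2.mem_nhds (hO p).1)
    have hpf := htK hp
    rw [hK.frontier_eq] at hpf
    have hWK : ¬ W ⊆ ⋂ r, A r := fun h =>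
      hpf.2 (mem_interior_iff_mem_nhds.2 (mem_of_superset hW h))
    obtain ⟨y, hyW, hyK⟩ := not_subset.1 hWK
    obtain ⟨r₀, hr₀⟩ := not_forall.1 (mt mem_iInter.2 hyK)
    filter_upwards [eventually_ge_atTop r₀] with r hr
    obtain ⟨z, hzW, hz⟩ := hWc.inter_frontier_nonempty_of_inter_compl
      ⟨p, mem_of_mem_nhds hW, mem_iInter.1 hpf.1 r⟩ ⟨y, hyW, fun h => hr₀ (hA hr h)⟩
    exact ⟨z, hWO hzW, hz⟩
  obtain ⟨r, hr⟩ := ((eventually_all_finite t.finite_toSet).2 hr).exists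
  choose! g hg using hr
  have hginj : InjOn g t := by
    intro p hp q hq hpq
    by_contra hne
    exact (hOd hp hq hne).notMem_of_mem_left (hg p hp).1 (hpq ▸ (hg q hq).1)
  have hcard : (g '' t).ncard = m + 1 := by
    rw [hginj.ncard_image, ncard_coe_finset, htc]
  have hle : (g '' t).ncard ≤ (frontier (A r)).ncard := by
    refine ncard_le_ncard ?_ (hfin r)
    rintro _ ⟨p, hp, rfl⟩
    exact (hg p hp).2
  have := hm r
  omega

theorem ncard_frontier_image (f : X ≃ₜ X) (A : Set X) :
    (frontier (f '' A)).ncard = (frontier A).ncard := by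
  rw [← f.image_frontier, ncard_image_of_injective _ f.injective]

/-- There is a closed neighbourhood of `N` disjoint from `N'`, with finite boundary, such that
its successive intersections with its forward images decrease to a set with finite boundary. -/
theorem regularCurveAx.exists_antitone_isClosed [CompactSpace X] [ConnectedSpace X]
    (hreg : regularCurveAx X) (f : X ≃ₜ X) {N N' : Set X} (hN : IsClosed N) (hN' : IsClosed N')
    (hfN : f '' N = N) (hfN' : f '' N' = N') (hd : Disjoint N N') :
    ∃ A : ℕ → Set X, Antitone A ∧ (∀ r, IsClosed (A r)) ∧ (∀ r, N ⊆ interior (A r)) ∧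
      Disjoint (A 0) N' ∧ (∀ r, A (r + 1) = A 0 ∩ f '' A r) ∧
      (frontier (⋂ r, A r)).Finite := by
  have := hreg.locallyConnectedSpace
  let P : Set X → Prop := fun A =>
    IsClosed A ∧ N ⊆ interior A ∧ Disjoint A N' ∧ (frontier A).Finite
  have himg : ∀ A, P A → P (f '' A) := by
    rintro A ⟨hA, hNA, hAd, hAf⟩
    refine ⟨f.isClosed_image.2 hA, ?_, ?_, ?_⟩
    · rw [← f.image_interior]
      exact hfN.symm.subset.trans (image_mono hNA)
    · rw [← hfN', disjoint_image_iff f.injective]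
      exact hAd
    · rw [← f.image_frontier]
      exact hAf.image _
  have hinter : ∀ A B, P A → P B → P (A ∩ B) := by
    rintro A B ⟨hA, hNA, hAd, hAf⟩ ⟨hB, hNB, hBd, hBf⟩
    refine ⟨hA.inter hB, ?_, hAd.mono_left inter_subset_left, ?_⟩
    · rw [interior_inter]
      exact subset_inter hNA hNB
    · exact (hAf.union hBf).subset ((frontier_inter_subset A B).trans
        (union_subset_union inter_subset_left inter_subset_right))
  have hunion : ∀ A B, P A → P B → P (A ∪ B) := by
    rintro A B ⟨hA, hNA, hAd, hAf⟩ ⟨hB, hNB, hBd, hBf⟩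
    refine ⟨hA.union hB, hNA.trans (interior_mono subset_union_left), hAd.union_left hBd, ?_⟩
    exact (hAf.union hBf).subset ((frontier_union_subset A B).trans
        (union_subset_union inter_subset_left inter_subset_right))
  obtain ⟨A₀, hA₀, hmin⟩ : ∃ A, P A ∧ ∀ B, P B → (frontier A).ncard ≤ (frontier B).ncard := by
    obtain ⟨A, hA, hmin⟩ := exists_minimalFor_of_wellFoundedLT P (fun A => (frontier A).ncard)
      (hreg.exists_isClosed_finite_frontier hN hN' hd)
    exact ⟨A, hA, fun B hB => (le_total _ _).elim id (hmin hB)⟩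
  let A : ℕ → Set X := fun r => Nat.rec A₀ (fun _ B => A₀ ∩ f '' B) r
  have hsucc : ∀ r, A (r + 1) = A₀ ∩ f '' A r := fun r => rfl
  have hA : ∀ r, P (A r) ∧ (frontier (A r)).ncard ≤ (frontier A₀).ncard := by
    intro r
    induction r with
    | zero => exact ⟨hA₀, le_rfl⟩
    | succ r ih =>
      have hi := himg _ ih.1
      refine ⟨hinter _ _ hA₀ hi, ?_⟩
      have h₁ := ncard_frontier_inter_add_ncard_frontier_union_le hA₀.2.2.2 hi.2.2.2
      have h₂ := hmin _ (hunion _ _ hA₀ hi)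
      have h₃ := ncard_frontier_image f (A r)
      have h₄ := ih.2
      rw [hsucc]
      omega
  have hanti : Antitone A := by
    refine antitone_nat_of_succ_le fun r => ?_
    induction r with
    | zero => exact inter_subset_left
    | succ r ih => exact inter_subset_inter_right _ (image_mono ih)
  exact ⟨A, hanti, fun r => (hA r).1.1, fun r => (hA r).1.2.1, hA₀.2.2.1, hsucc,
    finite_frontier_iInter hanti (fun r => (hA r).1.1) (fun r => (hA r).1.2.2.2)
      fun r => (hA r).2⟩

/-- In a regular curve, no forward orbit of a homeomorphism accumulates at two disjoint closed
invariant sets. -/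
theorem regularCurveAx.not_frequently_of_disjoint [CompactSpace X] [ConnectedSpace X]
    (hreg : regularCurveAx X) (f : X ≃ₜ X) {N N' : Set X} (hN : IsClosed N) (hN' : IsClosed N')
    (hfN : f '' N = N) (hfN' : f '' N' = N') (hd : Disjoint N N') {b : X}
    (hb : ∀ V, IsOpen V → N ⊆ V → ∃ᶠ i in atTop, f^[i] b ∈ V)
    (hb' : ∀ V, IsOpen V → N' ⊆ V → ∃ᶠ i in atTop, f^[i] b ∈ V) : False := by
  obtain ⟨A, hanti, hAc, hNA, hAN', hsucc, hKfin⟩ :=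
    hreg.exists_antitone_isClosed f hN hN' hfN hfN' hd
  have hbA : ∃ᶠ i in atTop, f^[i] b ∈ (A 0)ᶜ :=
    hb' _ (hAc 0).isOpen_compl (subset_compl_iff_disjoint_left.2 hAN')
  set K := ⋂ r, A r
  have hKback : ∀ x, f x ∈ K → x ∈ K := by
    intro x hx
    refine mem_iInter.2 fun r => ?_
    have := mem_iInter.1 hx (r + 1)
    rw [hsucc] at this
    exact f.injective.mem_set_image.1 this.2
  obtain ⟨s, hs⟩ := hbA.exists
  have hsK : ∀ i, s ≤ i → f^[i] b ∉ K := by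
    intro i hi
    induction i, hi using Nat.le_induction with
    | base => exact fun h => hs (mem_iInter.1 h 0)
    | succ i hi ih =>
      rw [Function.iterate_succ_apply']
      exact fun h => ih (hKback _ h)
  set Y := closure ((fun i => f^[i] b) '' Ici s)
  have hYf : ∀ x ∈ Y, f x ∈ Y := by
    intro x hx
    refine map_mem_closure f.continuous hx ?_
    rintro _ ⟨i, hi, rfl⟩
    exact ⟨i + 1, le_trans hi (Nat.le_succ i), Function.iterate_succ_apply' _ _ _⟩
  have hKY : (K ∩ Y).Finite := by
    refine hKfin.subset ?_
    rintro x ⟨hxK, hxY⟩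
    refine ⟨subset_closure hxK, fun hxi => ?_⟩
    obtain ⟨_, hz, i, hi, rfl⟩ := mem_closure_iff.1 hxY _ isOpen_interior hxi
    exact hsK i hi (interior_subset hz)
  obtain ⟨W, hW, hNW, hWd⟩ : ∃ W, IsOpen W ∧ N ⊆ W ∧ closure W ∩ ((K ∩ Y) \ N) = ∅ := by
    have hS : IsClosed ((K ∩ Y) \ N) := (hKY.subset sdiff_subset).isClosed
    obtain ⟨W, hW, hNW, hWS⟩ := normal_exists_closure_subset hN hS.isOpen_compl
      (fun x hx h => h.2 hx)
    exact ⟨W, hW, hNW, disjoint_iff_inter_eq_empty.1 (subset_compl_iff_disjoint_right.1 hWS)⟩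
  set O := W ∩ f ⁻¹' (W ∩ interior (A 0))
  have hOo : IsOpen O := hW.inter ((hW.inter isOpen_interior).preimage f.continuous)
  have hNO : N ⊆ O := fun x hx =>
    ⟨hNW hx, hNW (hfN ▸ mem_image_of_mem f hx), hNA 0 (hfN ▸ mem_image_of_mem f hx)⟩
  let B : ℕ → Set X := fun r => A r ∩ closure W ∩ Y
  have hBanti : Antitone B := fun r r' h =>
    inter_subset_inter_left _ (inter_subset_inter_left _ (hanti h))
  obtain ⟨r, hr⟩ : ∃ r, B r ⊆ O := by
    refine exists_subset_nhds_of_isCompact hBanti.directed_ge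
      (fun r => (((hAc r).inter isClosed_closure).inter isClosed_closure).isCompact) ?_
    intro x hx
    refine hOo.mem_nhds (hNO ?_)
    by_contra hxN
    have hx' := mem_iInter.1 hx
    have : x ∈ closure W ∩ ((K ∩ Y) \ N) :=
      ⟨(hx' 0).1.2, ⟨mem_iInter.2 fun r => (hx' r).1.1, (hx' 0).2⟩, hxN⟩
    rw [hWd] at this
    exact this
  have hstep : ∀ z ∈ B r, f z ∈ B r := by
    intro z hz
    have hzO := hr hz
    refine ⟨⟨hanti (Nat.le_succ r) ?_, subset_closure hzO.2.1⟩, hYf z hz.2⟩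
    rw [hsucc]
    exact ⟨interior_subset hzO.2.2, mem_image_of_mem f hz.1.1⟩
  obtain ⟨i, hiV, hi⟩ := ((hb (interior (A r) ∩ W) (isOpen_interior.inter hW)
    (subset_inter (hNA r) hNW)).and_eventually (eventually_ge_atTop s)).exists
  have hstay : ∀ j, i ≤ j → f^[j] b ∈ B r := by
    intro j hj
    induction j, hj using Nat.le_induction with
    | base => exact ⟨⟨interior_subset hiV.1, subset_closure hiV.2⟩, subset_closure ⟨i, hi, rfl⟩⟩
    | succ j hj ih =>
      rw [Function.iterate_succ_apply']
      exact hstep _ ih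
  obtain ⟨j, hjA, hj⟩ := (hbA.and_eventually (eventually_ge_atTop i)).exists
  exact hjA (hanti (Nat.zero_le r) (hstay j hj).1.1)

theorem Homeomorph.image_eq_self_iff {f : X ≃ₜ X} {S : Set X} :
    f '' S = S ↔ ∀ x, f x ∈ S ↔ x ∈ S := by
  constructor
  · intro h x
    nth_rewrite 1 [← h]
    exact f.injective.mem_set_image
  · intro h
    ext x
    obtain ⟨y, rfl⟩ := f.surjective x
    rw [f.injective.mem_set_image, h]

theorem Homeomorph.zpow_apply_mem_iff {f : X ≃ₜ X} {S : Set X} (h : f '' S = S) (t : ℤ) (x : X) :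
    (f ^ t) x ∈ S ↔ x ∈ S := by
  rw [Homeomorph.image_eq_self_iff] at h
  induction t using Int.induction_on generalizing x with
  | zero => rfl
  | succ n ih => rw [zpow_add_one, Homeomorph.mul_apply, ih, h]
  | pred n ih => rw [zpow_sub_one, Homeomorph.mul_apply, ih, ← h (f⁻¹ x),
      ← Homeomorph.mul_apply, mul_inv_cancel, Homeomorph.one_apply]

theorem Homeomorph.zpow_natCast_apply (f : X ≃ₜ X) (n : ℕ) (x : X) :
    (f ^ (n : ℤ)) x = f^[n] x := by
  induction n with
  | zero => rfl
  | succ n ih =>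
    rw [Function.iterate_succ_apply', ← ih, Nat.cast_succ, add_comm, zpow_one_add,
      Homeomorph.mul_apply]

theorem Homeomorph.zpow_neg_natCast_apply (f : X ≃ₜ X) (n : ℕ) (x : X) :
    (f ^ (-(n : ℤ))) x = f.symm^[n] x := by
  rw [zpow_neg, ← inv_zpow]
  exact Homeomorph.zpow_natCast_apply f.symm n x

theorem IsMinimalSet.subset_of_inter_nonempty {f : X ≃ₜ X} {M S : Set X}
    (hM : IsMinimalSet f M) (hS : IsClosed S) (hfS : f '' S = S) (h : (M ∩ S).Nonempty) :
    M ⊆ S := by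
  have := hM.2.2.2 (M ∩ S) inter_subset_left h (hM.2.1.inter hS)
    (by rw [image_inter f.injective, hM.2.2.1, hfS])
  exact inter_eq_left.1 this

theorem IsMinimalSet.eq_of_inter_nonempty {f : X ≃ₜ X} {M Q : Set X}
    (hM : IsMinimalSet f M) (hQ : IsMinimalSet f Q) (h : (M ∩ Q).Nonempty) : M = Q :=
  (hM.subset_of_inter_nonempty hQ.2.1 hQ.2.2.1 h).antisymm
    (hQ.subset_of_inter_nonempty hM.2.1 hM.2.2.1 (inter_comm M Q ▸ h))

theorem exists_isMinimalSet_subset [CompactSpace X] (f : X ≃ₜ X) {S : Set X}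
    (hne : S.Nonempty) (hS : IsClosed S) (hfS : f '' S = S) : ∃ Q ⊆ S, IsMinimalSet f Q := by
  obtain ⟨Q, hQS, hQ⟩ := zorn_superset_nonempty
    {Q : Set X | Q.Nonempty ∧ IsClosed Q ∧ f '' Q = Q} (fun c hc hchain hcne => by
      refine ⟨⋂₀ c, ⟨?_, isClosed_sInter fun s hs => (hc hs).2.1, ?_⟩,
        fun s hs => sInter_subset_of_mem hs⟩
      · have := hcne.to_subtype
        have hdir : DirectedOn (· ⊇ ·) c := fun a ha b hb =>
          (hchain.total ha hb).elim (fun h => ⟨a, ha, Subset.rfl, h⟩)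
            fun h => ⟨b, hb, h, Subset.rfl⟩
        exact IsCompact.nonempty_sInter_of_directed_nonempty_isCompact_isClosed hdir
          (fun s hs => (hc hs).1) (fun s hs => (hc hs).2.1.isCompact) fun s hs => (hc hs).2.1
      · rw [Homeomorph.image_eq_self_iff]
        intro x
        simp only [mem_sInter]
        exact forall₂_congr fun s hs => Homeomorph.image_eq_self_iff.1 (hc hs).2.2 x)
    S ⟨hne, hS, hfS⟩
  exact ⟨Q, hQS, hQ.prop.1, hQ.prop.2.1, hQ.prop.2.2, fun N hNQ hN hNc hfN =>
    hNQ.antisymm (hQ.le_of_le ⟨hN, hNc, hfN⟩ hNQ)⟩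

/-- The union of the two-sided orbits of the points of `S`. -/
def orbitUnion (f : X ≃ₜ X) (S : Set X) : Set X := ⋃ t : ℤ, (f ^ t) '' S

theorem mem_orbitUnion {f : X ≃ₜ X} {S : Set X} {x : X} :
    x ∈ orbitUnion f S ↔ ∃ t : ℤ, x ∈ (f ^ t) '' S :=
  mem_iUnion

theorem subset_orbitUnion (f : X ≃ₜ X) (S : Set X) : S ⊆ orbitUnion f S := fun x hx =>
  mem_orbitUnion.2 ⟨0, x, hx, rfl⟩

theorem image_orbitUnion (f : X ≃ₜ X) (S : Set X) : f '' orbitUnion f S = orbitUnion f S := by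
  rw [Homeomorph.image_eq_self_iff]
  intro x
  simp only [mem_orbitUnion, mem_image]
  constructor
  · rintro ⟨t, z, hz, hzx⟩
    refine ⟨t - 1, z, hz, f.injective ?_⟩
    rw [← hzx, ← Homeomorph.mul_apply, ← zpow_one_add, add_sub_cancel]
  · rintro ⟨t, z, hz, rfl⟩
    exact ⟨1 + t, z, hz, by rw [zpow_one_add, Homeomorph.mul_apply]⟩

theorem image_closure_orbitUnion (f : X ≃ₜ X) (S : Set X) :
    f '' closure (orbitUnion f S) = closure (orbitUnion f S) := by
  rw [f.image_closure, image_orbitUnion]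

theorem isOpen_orbitUnion (f : X ≃ₜ X) {S : Set X} (hS : IsOpen S) : IsOpen (orbitUnion f S) :=
  isOpen_iUnion fun t => (f ^ t).isOpen_image.2 hS

theorem IsMinimalSet.subset_orbitUnion_of_isOpen {f : X ≃ₜ X} {M U : Set X} (hM : IsMinimalSet f M)
    (hU : IsOpen U) (h : (M ∩ U).Nonempty) : M ⊆ orbitUnion f U := by
  by_contra hsub
  obtain ⟨x, hxM, hxU⟩ := not_subset.1 hsub
  obtain ⟨z, hzM, hzU⟩ := h
  refine hM.subset_of_inter_nonempty (isOpen_orbitUnion f hU).isClosed_compl ?_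
    ⟨x, hxM, hxU⟩ hzM (subset_orbitUnion f U hzU)
  rw [image_compl_eq f.bijective, image_orbitUnion]

theorem IsMinimalSet.frequently_mem_of_mem_closure_orbitUnion {f : X ≃ₜ X} {Q : Set X}
    (hQ : IsMinimalSet f Q) {q c : X} (hq : q ∈ Q) (hqc : q ∈ closure (orbitUnion f {c})) :
    (∀ V, IsOpen V → Q ⊆ V → ∃ᶠ i in atTop, f^[i] c ∈ V) ∨
      ∀ V, IsOpen V → Q ⊆ V → ∃ᶠ i in atTop, f.symm^[i] c ∈ V := by
  by_contra! hcon
  obtain ⟨⟨V₁, hV₁, hQ₁, h₁⟩, V₂, hV₂, hQ₂, h₂⟩ := hcon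
  obtain ⟨n, hn⟩ := eventually_atTop.1 (h₁.and h₂)
  have hG : ((fun t : ℤ => (f ^ t) c) '' Icc (-n : ℤ) n).Finite := (finite_Icc _ _).image _
  have hqG : q ∈ (fun t : ℤ => (f ^ t) c) '' Icc (-n : ℤ) n := by
    by_contra hqG
    obtain ⟨z, ⟨⟨hz₁, hz₂⟩, hzG⟩, hz⟩ := mem_closure_iff.1 hqc _
      ((hV₁.inter hV₂).inter hG.isClosed.isOpen_compl) ⟨⟨hQ₁ hq, hQ₂ hq⟩, hqG⟩
    obtain ⟨t, _, rfl, rfl⟩ := mem_orbitUnion.1 hz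
    obtain ⟨k, rfl | rfl⟩ := t.eq_nat_or_neg
    · by_cases hk : n ≤ k
      · exact (hn k hk).1 (Homeomorph.zpow_natCast_apply f k _ ▸ hz₁)
      · exact hzG ⟨k, ⟨by omega, by omega⟩, rfl⟩
    · by_cases hk : n ≤ k
      · exact (hn k hk).2 (Homeomorph.zpow_neg_natCast_apply f k _ ▸ hz₂)
      · exact hzG ⟨-k, ⟨by omega, by omega⟩, rfl⟩
  obtain ⟨t, -, rfl⟩ := hqG
  have hc : c ∈ Q := (Homeomorph.zpow_apply_mem_iff hQ.2.2.1 t c).1 hq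
  refine (hn n le_rfl).1 (hQ₁ ?_)
  rw [← Homeomorph.zpow_natCast_apply, Homeomorph.zpow_apply_mem_iff hQ.2.2.1]
  exact hc

theorem closure_orbitUnion_of_finite (f : X ≃ₜ X) {F : Set X} (hF : F.Finite) :
    closure (orbitUnion f F) = ⋃ c ∈ F, closure (orbitUnion f {c}) := by
  rw [← hF.closure_biUnion]
  congr 1
  ext x
  simp only [mem_iUnion, mem_orbitUnion, mem_image, mem_singleton_iff, exists_prop]
  constructor
  · rintro ⟨t, c, hc, rfl⟩
    exact ⟨c, hc, t, c, rfl, rfl⟩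
  · rintro ⟨c, hc, t, _, rfl, rfl⟩
    exact ⟨t, _, hc, rfl⟩

/-- The orbit closure of a finite subset of a regular curve contains only finitely many minimal
sets. -/
theorem regularCurveAx.finite_isMinimalSet_subset [CompactSpace X] [ConnectedSpace X]
    (hreg : regularCurveAx X) (f : X ≃ₜ X) {F : Set X} (hF : F.Finite) :
    {Q : Set X | IsMinimalSet f Q ∧ Q ⊆ closure (orbitUnion f F)}.Finite := by
  have hsub : ∀ g : X ≃ₜ X, (∀ Q, IsMinimalSet f Q → g '' Q = Q) → ∀ c,
      {Q : Set X | IsMinimalSet f Q ∧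
        ∀ V, IsOpen V → Q ⊆ V → ∃ᶠ i in atTop, g^[i] c ∈ V}.Subsingleton := by
    rintro g hg c Q ⟨hQ, hcQ⟩ Q' ⟨hQ', hcQ'⟩
    by_contra hne
    refine hreg.not_frequently_of_disjoint g hQ.2.1 hQ'.2.1 (hg Q hQ) (hg Q' hQ') ?_ hcQ hcQ'
    exact disjoint_iff_inter_eq_empty.2 (not_nonempty_iff_eq_empty.1
      fun h => hne (hQ.eq_of_inter_nonempty hQ' h))
  have hsymm : ∀ Q, IsMinimalSet f Q → f.symm '' Q = Q := fun Q hQ => by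
    nth_rewrite 1 [← hQ.2.2.1]
    exact f.toEquiv.symm_image_image Q
  refine (hF.biUnion fun c _ => (hsub f (fun Q hQ => hQ.2.2.1) c).finite.union
    (hsub f.symm hsymm c).finite).subset ?_
  rintro Q ⟨hQ, hQF⟩
  obtain ⟨q, hq⟩ := hQ.1
  have hqF := hQF hq
  rw [closure_orbitUnion_of_finite f hF] at hqF
  obtain ⟨c, hc, hqc⟩ := mem_iUnion₂.1 hqF
  exact mem_iUnion₂.2 ⟨c, hc, (hQ.frequently_mem_of_mem_closure_orbitUnion hq hqc).imp
    (fun h => ⟨hQ, h⟩) fun h => ⟨hQ, h⟩⟩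

theorem IsMinimalSet.exists_mem_closure_image_zpow {f : X ≃ₜ X} [CompactSpace X] {M D : Set X}
    (hM : IsMinimalSet f M) (hD : IsOpen D) (hMD : (M ∩ D).Nonempty)
    (hdisj : ∀ s t : ℤ, ((f ^ s) '' D ∩ (f ^ t) '' D).Nonempty → (f ^ s) '' D = (f ^ t) '' D)
    {x : X} (hx : x ∈ closure (orbitUnion f D)) : ∃ t : ℤ, x ∈ closure ((f ^ t) '' D) := by
  obtain ⟨T, hT⟩ := hM.2.1.isCompact.elim_finite_subcover (fun t : ℤ => (f ^ t) '' D)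
    (fun t => (f ^ t).isOpen_image.2 hD) (hM.subset_orbitUnion_of_isOpen hD hMD)
  have hsub : orbitUnion f D ⊆ ⋃ t ∈ T, (f ^ t) '' D := by
    refine iUnion_subset fun s => ?_
    obtain ⟨m, hmM, hmD⟩ := hMD
    obtain ⟨t, htT, ht⟩ := mem_iUnion₂.1
      (hT ((Homeomorph.zpow_apply_mem_iff hM.2.2.1 s m).2 hmM))
    rw [hdisj s t ⟨_, mem_image_of_mem _ hmD, ht⟩]
    exact subset_biUnion_of_mem (u := fun t : ℤ => (f ^ t) '' D) htT
  have := closure_mono hsub hx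
  rw [T.closure_biUnion] at this
  obtain ⟨t, -, ht⟩ := mem_iUnion₂.1 this
  exact ⟨t, ht⟩

theorem exists_dist_le_of_mem_closure_orbitUnion {f : X ≃ₜ X} {D N : Set X} {ρ : ℝ}
    (hD : ∀ x ∈ closure (orbitUnion f D), ∃ t : ℤ, x ∈ closure ((f ^ t) '' D))
    (hρ : ∀ t : ℤ, ∀ x ∈ (f ^ t) '' D, ∀ y ∈ (f ^ t) '' D, dist x y ≤ ρ)
    (hN : N.Nonempty) (hfN : f '' N = N) (hND : N ⊆ closure (orbitUnion f D))
    {x : X} (hx : x ∈ closure (orbitUnion f D)) : ∃ ν ∈ N, dist x ν ≤ ρ := by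
  obtain ⟨ν, hν⟩ := hN
  obtain ⟨s, hs⟩ := hD ν (hND hν)
  obtain ⟨t, ht⟩ := hD x hx
  refine ⟨(f ^ (t - s)) ν, (Homeomorph.zpow_apply_mem_iff hfN _ _).2 hν, ?_⟩
  have hνt : (f ^ (t - s)) ν ∈ closure ((f ^ t) '' D) := by
    have := mem_image_of_mem (f ^ (t - s)) hs
    rw [(f ^ (t - s)).image_closure, ← image_comp] at this
    convert this using 3
    rw [← sub_add_cancel t s, zpow_add, add_sub_cancel_right]
    rfl
  have hsub : closure ((f ^ t) '' D) ×ˢ closure ((f ^ t) '' D) ⊆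
      {p : X × X | dist p.1 p.2 ≤ ρ} := by
    rw [← closure_prod_eq]
    exact closure_minimal (fun p hp => hρ t _ hp.1 _ hp.2)
      (isClosed_le continuous_dist continuous_const)
  exact hsub (mk_mem_prod ht hνt)

theorem Homeomorph.image_zpow_connectedComponentIn_compl {f : X ≃ₜ X} {Z : Set X}
    (hfZ : f '' Z = Z) {x : X} (hx : x ∉ Z) (t : ℤ) :
    (f ^ t) '' connectedComponentIn Zᶜ x = connectedComponentIn Zᶜ ((f ^ t) x) := by
  rw [(f ^ t).image_connectedComponentIn hx]
  congr 1
  ext y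
  obtain ⟨z, rfl⟩ := (f ^ t).surjective y
  rw [(f ^ t).injective.mem_set_image, mem_compl_iff, mem_compl_iff,
    Homeomorph.zpow_apply_mem_iff hfZ]

theorem IsMinimalSet.exists_mem_closure_image_zpow_connectedComponentIn [CompactSpace X]
    [LocallyConnectedSpace X] {f : X ≃ₜ X} {M Z : Set X} (hM : IsMinimalSet f M)
    (hZ : IsClosed Z) (hfZ : f '' Z = Z) {x : X} (hx : x ∉ Z)
    (hMx : (M ∩ connectedComponentIn Zᶜ x).Nonempty) {y : X}
    (hy : y ∈ closure (orbitUnion f (connectedComponentIn Zᶜ x))) :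
    ∃ t : ℤ, y ∈ closure ((f ^ t) '' connectedComponentIn Zᶜ x) := by
  refine hM.exists_mem_closure_image_zpow hZ.isOpen_compl.connectedComponentIn hMx ?_ hy
  intro s t h
  simp only [Homeomorph.image_zpow_connectedComponentIn_compl hfZ hx] at h ⊢
  obtain ⟨z, hz₁, hz₂⟩ := h
  rw [connectedComponentIn_eq hz₁, connectedComponentIn_eq hz₂]

theorem frontier_connectedComponentIn_subset [LocallyConnectedSpace X] {U : Set X}
    (hU : IsOpen U) (x : X) : frontier (connectedComponentIn U x) ⊆ Uᶜ := by
  intro p hp hpU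
  rw [hU.connectedComponentIn.frontier_eq] at hp
  obtain ⟨z, hz, hzx⟩ := mem_closure_iff.1 hp.1 _ hU.connectedComponentIn
    (mem_connectedComponentIn hpU)
  refine hp.2 ?_
  rw [connectedComponentIn_eq hzx, ← connectedComponentIn_eq hz]
  exact mem_connectedComponentIn hpU

/-- If `Z` is closed and invariant and the components of `Zᶜ` along the orbit of a point of a
minimal set `M` are proper and of diameter at most `ρ`, then some minimal subset of `Z` is at
Hausdorff distance at most `ρ` from `M`. -/
theorem IsMinimalSet.exists_isMinimalSet_hausdorffDist_le [CompactSpace X] [ConnectedSpace X]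
    [LocallyConnectedSpace X] {f : X ≃ₜ X} {M Z : Set X} (hM : IsMinimalSet f M)
    (hZ : IsClosed Z) (hfZ : f '' Z = Z) {m : X} (hm : m ∈ M) (hmZ : m ∉ Z)
    (hD : connectedComponentIn Zᶜ m ≠ univ) {ρ : ℝ} (hρ₀ : 0 ≤ ρ)
    (hρ : ∀ t : ℤ, ∀ x ∈ connectedComponentIn Zᶜ ((f ^ t) m),
      ∀ y ∈ connectedComponentIn Zᶜ ((f ^ t) m), dist x y ≤ ρ) :
    ∃ Q ⊆ Z, IsMinimalSet f Q ∧ hausdorffDist M Q ≤ ρ := by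
  simp only [← Homeomorph.image_zpow_connectedComponentIn_compl hfZ hmZ] at hρ
  set D := connectedComponentIn Zᶜ m
  have hDo : IsOpen D := hZ.isOpen_compl.connectedComponentIn
  have hmD : m ∈ D := mem_connectedComponentIn hmZ
  obtain ⟨p, hp⟩ := nonempty_frontier_iff.2 ⟨⟨m, hmD⟩, hD⟩
  have hpZ : p ∈ Z :=
    notMem_compl_iff.1 (frontier_connectedComponentIn_subset hZ.isOpen_compl m hp)
  obtain ⟨Q, hQsub, hQ⟩ := exists_isMinimalSet_subset f
    (S := closure (orbitUnion f D) ∩ Z)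
    ⟨p, closure_mono (subset_orbitUnion f D) (frontier_subset_closure hp), hpZ⟩
    (isClosed_closure.inter hZ)
    (by rw [image_inter f.injective, image_closure_orbitUnion, hfZ])
  have hMD : (M ∩ D).Nonempty := ⟨m, hm, hmD⟩
  have hMsub : M ⊆ closure (orbitUnion f D) :=
    (hM.subset_orbitUnion_of_isOpen hDo hMD).trans subset_closure
  have hcl := fun y => hM.exists_mem_closure_image_zpow_connectedComponentIn hZ hfZ hmZ hMD
    (y := y)
  refine ⟨Q, fun q hq => (hQsub hq).2, hQ, hausdorffDist_le_of_mem_dist hρ₀ ?_ ?_⟩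
  · exact fun x hx => exists_dist_le_of_mem_closure_orbitUnion hcl hρ hQ.1 hQ.2.2.1
      (fun q hq => (hQsub hq).1) (hMsub hx)
  · exact fun x hx => exists_dist_le_of_mem_closure_orbitUnion hcl hρ hM.1 hM.2.2.1
      hMsub (hQsub hx).1

end RegularCurve

/-- The collection of all minimal sets of a homeomorphism of a regular curve is
closed in the hyperspace of nonempty closed (= compact) subsets of X with the
Hausdorff metric. -/
theorem minimalSets_isClosed {X : Type*} [MetricSpace X] [Nonempty X]
    [CompactSpace X] [ConnectedSpace X] (hreg : regularCurveAx X) (f : X ≃ₜ X) :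
    IsClosed {K : TopologicalSpace.NonemptyCompacts X | IsMinimalSet (⇑f) (K : Set X)} := by
  have := hreg.locallyConnectedSpace
  refine isClosed_of_closure_subset fun L hL => ?_
  rw [mem_closure_iff_frequently] at hL
  by_contra hLmin
  have hfL : f '' L = L := by
    have hcl : IsClosed {K : TopologicalSpace.NonemptyCompacts X |
        K.map f f.continuous = K} :=
      isClosed_eq f.continuous.nonemptyCompacts_map continuous_id
    have : L.map f f.continuous = L := hcl.closure_subset
      (mem_closure_iff_frequently.2 (hL.mono fun M hM => SetLike.coe_injective hM.2.2.1))
    exact congrArg SetLike.coe this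
  obtain ⟨N, hNL, hN, hNc, hfN, hNe⟩ : ∃ N : Set X, N ⊆ L ∧ N.Nonempty ∧ IsClosed N ∧
      f '' N = N ∧ N ≠ L := by
    by_contra! hcon
    exact hLmin ⟨L.nonempty, L.isCompact.isClosed, hfL, hcon⟩
  obtain ⟨y, hyL, hyN⟩ := not_subset.1 fun h => hNe (hNL.antisymm h)
  obtain ⟨ε, hε, hεN⟩ : ∃ ε > 0, ∀ ν ∈ N, ε < dist y ν := by
    have hpos := (hNc.notMem_iff_infDist_pos hN).1 hyN
    exact ⟨infDist y N / 2, half_pos hpos, fun ν hν =>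
      (half_lt_self hpos).trans_le (infDist_le_dist_of_mem hν)⟩
  obtain ⟨F, hF, hFε⟩ := hreg.exists_finite_forall_dist_lt hε
  set Z := closure (orbitUnion f F)
  have hZ : IsClosed Z := isClosed_closure
  have hfZ : f '' Z = Z := image_closure_orbitUnion f F
  have hDε : ∀ φ, ∀ x ∈ connectedComponentIn Zᶜ φ, ∀ x' ∈ connectedComponentIn Zᶜ φ,
      dist x x' < ε := fun φ => by
    refine hFε _ isPreconnected_connectedComponentIn
      (disjoint_left.2 fun x hx hxF => connectedComponentIn_subset _ _ hx ?_)
    exact subset_closure (subset_orbitUnion f F hxF)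
  have hDne : ∀ φ, connectedComponentIn Zᶜ φ ≠ univ := by
    intro φ h
    obtain ⟨ν, hν⟩ := hN
    exact lt_asymm (hεN ν hν) (hDε φ y (h ▸ mem_univ y) ν (h ▸ mem_univ ν))
  obtain ⟨δ, hδ, hLδ⟩ : ∃ δ > 0, ∀ Q : TopologicalSpace.NonemptyCompacts X,
      IsMinimalSet f Q → (Q : Set X) ⊆ Z → δ ≤ dist Q L := by
    have hfin : {Q : TopologicalSpace.NonemptyCompacts X |
        IsMinimalSet f Q ∧ (Q : Set X) ⊆ Z}.Finite :=
      (hreg.finite_isMinimalSet_subset f hF).preimage SetLike.coe_injective.injOn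
    obtain ⟨δ, hδ, hball⟩ := Metric.mem_nhds_iff.1
      (hfin.isClosed.isOpen_compl.mem_nhds fun h : L ∈ _ => hLmin h.1)
    exact ⟨δ, hδ, fun Q hQ hQZ => not_lt.1 fun h => hball h ⟨hQ, hQZ⟩⟩
  obtain ⟨F', hF', hFη⟩ := hreg.exists_finite_forall_dist_lt (half_pos hδ)
  have hfreq : ∃ᶠ M : TopologicalSpace.NonemptyCompacts X in 𝓝 L, ∃ φ ∈ F',
      φ ∉ Z ∧ IsMinimalSet f M ∧ ((M : Set X) ∩ connectedComponentIn Zᶜ φ).Nonempty := by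
    refine (hL.and_eventually (ball_mem_nhds L (half_pos hδ))).mono ?_
    rintro M ⟨hM, hML⟩
    obtain ⟨m, hm⟩ := hM.1
    have hmZ : m ∉ Z := fun hmZ => absurd
      (hLδ M hM (hM.subset_of_inter_nonempty hZ hfZ ⟨m, hm, hmZ⟩)) (by linarith)
    by_contra! hcon
    obtain ⟨Q, hQZ, hQ, hMQ⟩ := hM.exists_isMinimalSet_hausdorffDist_le hZ hfZ hm hmZ (hDne m)
      (half_pos hδ).le (fun t x hx x' hx' => by
        refine (hFη _ isPreconnected_connectedComponentIn ?_ x hx x' hx').le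
        refine disjoint_left.2 fun φ hφ hφF => ?_
        have := hcon φ hφF (connectedComponentIn_subset _ _ hφ) hM
        rw [← connectedComponentIn_eq hφ] at this
        refine this.subset ⟨(Homeomorph.zpow_apply_mem_iff hM.2.2.1 t m).2 hm,
          mem_connectedComponentIn fun h => hmZ ((Homeomorph.zpow_apply_mem_iff hfZ t m).1 h)⟩)
    have hQL := hLδ ⟨⟨Q, hQ.2.1.isCompact⟩, hQ.1⟩ hQ hQZ
    have hQM : dist (⟨⟨Q, hQ.2.1.isCompact⟩, hQ.1⟩ : TopologicalSpace.NonemptyCompacts X) M ≤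
        δ / 2 := by
      rw [dist_comm]
      exact hMQ
    linarith [dist_triangle
      (⟨⟨Q, hQ.2.1.isCompact⟩, hQ.1⟩ : TopologicalSpace.NonemptyCompacts X) M L]
  obtain ⟨φ, -, hφ⟩ := (frequently_exists_finite hF').1 hfreq
  obtain ⟨M, hφZ, hM, hMφ⟩ := hφ.exists
  set D := connectedComponentIn Zᶜ φ
  have hLsub : (L : Set X) ⊆ closure (orbitUnion f D) := by
    refine (TopologicalSpace.NonemptyCompacts.isClosed_subsets_of_isClosed
      (isClosed_closure (s := orbitUnion f D))).closure_subset
      (mem_closure_iff_frequently.2 (hφ.mono fun M hM => ?_))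
    exact (hM.2.1.subset_orbitUnion_of_isOpen hZ.isOpen_compl.connectedComponentIn hM.2.2).trans
      subset_closure
  obtain ⟨ν, hν, hyν⟩ := exists_dist_le_of_mem_closure_orbitUnion (ρ := ε)
    (fun x => hM.exists_mem_closure_image_zpow_connectedComponentIn hZ hfZ hφZ hMφ)
    (fun t x hx x' hx' => by
      rw [Homeomorph.image_zpow_connectedComponentIn_compl hfZ hφZ] at hx hx'
      exact (hDε _ x hx x' hx').le)
    hN hfN (hNL.trans hLsub) (hLsub hyL)
  exact (hεN ν hν).not_ge hyν
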